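/- Let 1/2 < δ < 1 and let M ∈ ℕ with M ≥ 4 and M^δ > 2. Let A = { l ∈ {0,…,M−1} : |l − M/2| ≤ M^δ/2 } and let g be the discrete Gaussian. Then for every x ∈ ℝ: |G_g(x) − G_{g·𝟙_A}(x)| ≤ (2/√M)·e^{−(π/4)·M^{2δ−1}}. -/

import Mathlib

open scoped Classical

noncomputable section

/-- `e^{-2πi x}` -/
def ec (x : ℝ) : ℂ := Complex.exp (-(2 * Real.pi * x) * Complex.I)

/-- The 1-periodic function `G_f(x) = M^{-1/2} Σ_{l ∈ ℤ} f(l) e^{-2πi l x}`. -/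
def Gf (M : ℕ) (f : ℤ → ℂ) (x : ℝ) : ℂ :=
  ((Real.sqrt M)⁻¹ : ℝ) * ∑' l : ℤ, f l * ec ((l : ℝ) * x)

/-- The alphabet `A = { l ∈ {0,…,M-1} : |l - M/2| ≤ M^δ/2 }`. -/
def alphabetA (M : ℕ) (δ : ℝ) : Finset ℕ :=
  (Finset.range M).filter fun l => |(l : ℝ) - (M : ℝ) / 2| ≤ (M : ℝ) ^ δ / 2

/-- The discrete Gaussian `g(l) = M^{-1/2} e^{-π(l-M/2)²/M} e^{iπl}`. -/
def gaussD (M : ℕ) : ℤ → ℂ := fun l =>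
  (((Real.sqrt M)⁻¹ * Real.exp (-(Real.pi * ((l : ℝ) - (M : ℝ) / 2) ^ 2 / (M : ℝ))) : ℝ) : ℂ) *
    Complex.exp ((Real.pi * (l : ℝ) : ℝ) * Complex.I)

/-- The restriction `f·𝟙_A` of `f : ℤ → ℂ` to an alphabet `A ⊆ ℕ`, extended by zero. -/
def restrictA (A : Finset ℕ) (f : ℤ → ℂ) : ℤ → ℂ := fun l =>
  if ∃ a ∈ A, l = (a : ℤ) then f l else 0


theorem aux_partial (M : ℕ) (hM4 : 4 ≤ M) (N : ℕ) :
    ∑ n ∈ Finset.range N, Real.exp (-(Real.pi / M) * (n : ℝ) ^ 2) ≤ Real.sqrt M := by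
  have hM0 : (0 : ℝ) < M := by
    have : 0 < M := by omega
    exact_mod_cast this
  have hb : 0 < Real.pi / (M : ℝ) := by positivity
  have hs2 : (2 : ℝ) ≤ Real.sqrt M := by
    apply Real.le_sqrt_of_sq_le
    have : (4 : ℝ) ≤ M := by exact_mod_cast hM4
    linarith
  rcases N with _ | N
  · simp
  rw [Finset.sum_range_succ']
  have hanti : AntitoneOn (fun t : ℝ => Real.exp (-(Real.pi / M) * t ^ 2))
      (Set.Icc (0 : ℝ) (0 + (N : ℕ))) := by
    intro a ha b hb' hab
    apply Real.exp_le_exp.mpr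
    have h1 : a ^ 2 ≤ b ^ 2 := pow_le_pow_left₀ ha.1 hab 2
    nlinarith
  have h1 := hanti.sum_le_integral
  have hint : MeasureTheory.Integrable (fun t : ℝ => Real.exp (-(Real.pi / M) * t ^ 2)) :=
    integrable_exp_neg_mul_sq hb
  have h2 : ∫ t in (0 : ℝ)..(0 + (N : ℕ)), Real.exp (-(Real.pi / M) * t ^ 2) ≤
      ∫ t in Set.Ioi (0 : ℝ), Real.exp (-(Real.pi / M) * t ^ 2) := by
    rw [intervalIntegral.integral_of_le (by positivity)]
    apply MeasureTheory.setIntegral_mono_set hint.integrableOn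
    · exact Filter.Eventually.of_forall fun t => (Real.exp_pos _).le
    · exact (Set.Ioc_subset_Ioi_self).eventuallyLE
  rw [integral_gaussian_Ioi] at h2
  have h3 : Real.pi / (Real.pi / (M : ℝ)) = M := by
    field_simp
  rw [h3] at h2
  simp only [zero_add] at h1 h2
  have h4 : Real.exp (-(Real.pi / M) * ((0 : ℕ) : ℝ) ^ 2) = 1 := by simp
  rw [h4]
  linarith

theorem aux_extend (j : ℕ → ℤ) (f : ℕ → ℝ) (hf : ∀ n, 0 ≤ f n) (l : ℤ) :
    0 ≤ Function.extend j f 0 l := by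
  rw [Function.extend_def]
  split_ifs
  · exact hf _
  · simp

theorem aux_norm_ec (x : ℝ) : ‖ec x‖ = 1 := by
  have : (-(2 * Real.pi * x) * Complex.I : ℂ) = ((-(2 * Real.pi * x) : ℝ) : ℂ) * Complex.I := by
    push_cast; ring
  rw [ec, this, Complex.norm_exp_ofReal_mul_I]

theorem aux_norm_g (M : ℕ) (l : ℤ) : ‖gaussD M l‖ =
    (Real.sqrt M)⁻¹ * Real.exp (-(Real.pi * ((l : ℝ) - (M : ℝ) / 2) ^ 2 / (M : ℝ))) := by
  rw [gaussD, norm_mul, Complex.norm_exp_ofReal_mul_I, mul_one, Complex.norm_real,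
    Real.norm_of_nonneg (by positivity)]

/-- `|G_g(x) - G_{g·𝟙_A}(x)| ≤ (2/√M) e^{-(π/4) M^{2δ-1}}`. -/
theorem stmt9 (δ : ℝ) (hδ1 : 1 / 2 < δ) (hδ2 : δ < 1) (M : ℕ) (hM4 : 4 ≤ M)
    (hMδ : 2 < (M : ℝ) ^ δ) (x : ℝ) :
    ‖Gf M (gaussD M) x - Gf M (restrictA (alphabetA M δ) (gaussD M)) x‖ ≤
      2 / Real.sqrt M * Real.exp (-(Real.pi / 4) * (M : ℝ) ^ (2 * δ - 1)) := by
  have hM4' : (4 : ℝ) ≤ M := by exact_mod_cast hM4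
  have hM0 : (0 : ℝ) < M := by linarith
  have hs0 : 0 < Real.sqrt M := Real.sqrt_pos.mpr hM0
  have hss : Real.sqrt M * Real.sqrt M = M := Real.mul_self_sqrt hM0.le
  obtain ⟨r, hr⟩ : ∃ r : ℝ, r = (M : ℝ) ^ δ / 2 := ⟨_, rfl⟩
  have hr1 : 1 < r := by rw [hr]; linarith
  have hrM : r < M / 2 := by
    have : (M : ℝ) ^ δ < (M : ℝ) ^ (1 : ℝ) :=
      Real.rpow_lt_rpow_of_exponent_lt (by linarith) hδ2
    rw [Real.rpow_one] at this
    rw [hr]; linarith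
  have hE : Real.exp (-(Real.pi / 4) * (M : ℝ) ^ (2 * δ - 1)) =
      Real.exp (-(Real.pi / M) * r ^ 2) := by
    congr 1
    rw [Real.rpow_sub hM0, Real.rpow_one, mul_comm 2 δ, Real.rpow_mul hM0.le, hr]
    norm_num
    field_simp
    norm_num
  rw [hE]
  set E := Real.exp (-(Real.pi / M) * r ^ 2) with hEdef
  have hE0 : 0 < E := Real.exp_pos _
  set u : ℕ → ℝ := fun n => Real.exp (-(Real.pi / M) * (n : ℝ) ^ 2) with hu
  have hu0 : ∀ n, 0 ≤ u n := fun n => (Real.exp_pos _).le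
  have husum : Summable u := summable_of_sum_range_le hu0 (aux_partial M hM4)
  have hule : ∑' n, u n ≤ Real.sqrt M := Real.tsum_le_of_sum_range_le hu0 (aux_partial M hM4)
  set v : ℕ → ℝ := fun n => (Real.sqrt M)⁻¹ * E * u n with hv
  have hv0 : ∀ n, 0 ≤ v n := fun n => by have := hu0 n; positivity
  have hvsum : HasSum v ((Real.sqrt M)⁻¹ * E * ∑' n, u n) := husum.hasSum.mul_left _
  obtain ⟨p, hp⟩ : ∃ p : ℤ, p = ⌊(M : ℝ) / 2 + r⌋ + 1 := ⟨_, rfl⟩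
  have hpr : (M : ℝ) / 2 + r < p := by
    rw [hp]; push_cast; exact Int.lt_floor_add_one _
  have hpl : ∀ l : ℤ, (M : ℝ) / 2 + r < l → p ≤ l := by
    intro l hl
    rw [hp]
    have : ⌊(M : ℝ) / 2 + r⌋ < l := Int.floor_lt.mpr hl
    omega
  set j1 : ℕ → ℤ := fun n => p + n with hj1
  set j2 : ℕ → ℤ := fun n => M - p - n with hj2
  have hj1i : Function.Injective j1 := fun a b h => by simp only [hj1] at h; omega
  have hj2i : Function.Injective j2 := fun a b h => by simp only [hj2] at h; omega
  have hF := ((hasSum_extend_zero hj1i).mpr hvsum).add ((hasSum_extend_zero hj2i).mpr hvsum)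
  have hkey : ∀ (l : ℤ) (n : ℕ), r + n ≤ |(l : ℝ) - M / 2| → ‖gaussD M l‖ ≤ v n := by
    intro l n h
    rw [aux_norm_g]
    simp only [hv, hu, hEdef]
    rw [mul_assoc, ← Real.exp_add]
    apply mul_le_mul_of_nonneg_left _ (by positivity)
    apply Real.exp_le_exp.mpr
    have hn : (0 : ℝ) ≤ n := by positivity
    have h2 : r ^ 2 + (n : ℝ) ^ 2 ≤ ((l : ℝ) - M / 2) ^ 2 := by
      rw [← sq_abs ((l : ℝ) - M / 2)]
      nlinarith
    have hb : 0 < Real.pi / (M : ℝ) := by positivity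
    have e : Real.pi * ((l : ℝ) - M / 2) ^ 2 / M = Real.pi / M * ((l : ℝ) - M / 2) ^ 2 := by ring
    rw [e]
    nlinarith
  set A := alphabetA M δ with hA
  set d : ℤ → ℂ := fun l =>
    gaussD M l * ec ((l : ℝ) * x) - restrictA A (gaussD M) l * ec ((l : ℝ) * x) with hd
  have hbound : ∀ l, ‖d l‖ ≤ Function.extend j1 v 0 l + Function.extend j2 v 0 l := by
    intro l
    have n1 := aux_extend j1 v hv0 l
    have n2 := aux_extend j2 v hv0 l
    by_cases hl : ∃ a ∈ A, l = (a : ℤ)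
    · have : d l = 0 := by simp [hd, restrictA, hl]
      rw [this, norm_zero]; linarith
    · have hdl : ‖d l‖ = ‖gaussD M l‖ := by
        simp only [hd, restrictA, if_neg hl, zero_mul, sub_zero, norm_mul, aux_norm_ec, mul_one]
      rw [hdl]
      have hgt : r < |(l : ℝ) - M / 2| := by
        by_contra hle
        push Not at hle
        apply hl
        have hab := abs_le.mp hle
        have l0 : (0 : ℝ) < l := by linarith
        have lM : (l : ℝ) < M := by linarith
        have l0' : 0 < l := by exact_mod_cast l0
        have lM' : l < M := by exact_mod_cast lM
        obtain ⟨a, rfl⟩ := Int.eq_ofNat_of_zero_le l0'.le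
        refine ⟨a, ?_, rfl⟩
        rw [hA, alphabetA, Finset.mem_filter, Finset.mem_range]
        refine ⟨by exact_mod_cast lM', ?_⟩
        rw [← hr]
        simpa using hle
      rcases lt_abs.mp hgt with h | h
      · have hpl' := hpl l (by linarith)
        obtain ⟨n, hn⟩ := Int.eq_ofNat_of_zero_le (sub_nonneg.mpr hpl')
        have hln : l = j1 n := by simp only [hj1]; omega
        have hlr : (l : ℝ) = p + n := by rw [hln]; simp [hj1]
        have hk := hkey l n (le_trans (by rw [hlr]; linarith) (le_abs_self _))
        have : Function.extend j1 v 0 l = v n := by rw [hln, hj1i.extend_apply]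
        linarith
      · have hpl' := hpl (M - l) (by push_cast; linarith)
        obtain ⟨n, hn⟩ := Int.eq_ofNat_of_zero_le (sub_nonneg.mpr hpl')
        have hln : l = j2 n := by simp only [hj2]; omega
        have hlr : (l : ℝ) = M - p - n := by rw [hln]; simp [hj2]
        have hk := hkey l n (le_trans (by rw [hlr]; linarith) (neg_le_abs _))
        have : Function.extend j2 v 0 l = v n := by rw [hln, hj2i.extend_apply]
        linarith
  have hdsum : Summable d := Summable.of_norm_bounded hF.summable hbound
  have hrsum : Summable fun l : ℤ => restrictA A (gaussD M) l * ec ((l : ℝ) * x) := by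
    apply summable_of_ne_finset_zero (s := A.image (fun a : ℕ => (a : ℤ)))
    intro l hl
    have : ¬ ∃ a ∈ A, l = (a : ℤ) := by
      rintro ⟨a, ha, rfl⟩
      exact hl (Finset.mem_image_of_mem _ ha)
    simp [restrictA, this]
  have hgsum : Summable fun l : ℤ => gaussD M l * ec ((l : ℝ) * x) := by
    have := hdsum.add hrsum
    simpa [hd] using this
  have hn := tsum_of_norm_bounded hF hbound
  rw [Gf, Gf, ← mul_sub, ← hgsum.tsum_sub hrsum, norm_mul, Complex.norm_real,
    Real.norm_of_nonneg (by positivity)]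
  calc (Real.sqrt M)⁻¹ * ‖∑' l, d l‖
      ≤ (Real.sqrt M)⁻¹ * ((Real.sqrt M)⁻¹ * E * ∑' n, u n + (Real.sqrt M)⁻¹ * E * ∑' n, u n) := by
        gcongr
    _ ≤ (Real.sqrt M)⁻¹ * ((Real.sqrt M)⁻¹ * E * Real.sqrt M
          + (Real.sqrt M)⁻¹ * E * Real.sqrt M) := by
        gcongr
    _ = 2 / Real.sqrt M * E := by
        field_simp
        ring

end
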